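/- The conciliation-with-core-set protocol satisfies strong unanimity: under the conditions that all honest listening sets contain only honest processes and share a common core G of size at least 2k+1, if every honest process has input v then every honest process returns v. -/

import Mathlib

open Classical in
/-- Strong unanimity of conciliation-with-core-set: each honest process `i` has input
`v i` and a listening set `L i ⊆ H` of size `3k+1`; all honest listening sets share a common
honest core `G` of size at least `2k+1`.  The honest broadcasters are `T = {i ∈ H : i ∈ L i}`;
`Ti i` is the set of senders honest `i` heard from (`T ⊆ Ti i`, honest members of `Ti i` are in
`T`); `vc i s` and `Lc i s` are the value and listening set claimed by sender `s` to `i`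
(truthful for honest `s`).  `m i z` is the minimum of the claimed values `vc i y` over
broadcasters `y` (with `y ∈ Lc i y`) having a path to `z` in the graph on `Ti i` with edges
`(a,b)` for `a ∈ Lc i b`; `out i` is a most frequently occurring value among
`{m i z : z ∈ Ti i ∩ L i}`.  If every honest process has input `w`, then every honest
process returns `w`. -/
theorem conciliation_strong_unanimity {V : Type} [LinearOrder V] {n k : ℕ}
    (H G : Finset (Fin n)) (L : Fin n → Finset (Fin n)) (v : Fin n → V)
    (hL : ∀ i ∈ H, (L i).card = 3 * k + 1)
    (hLH : ∀ i ∈ H, L i ⊆ H)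
    (hGH : G ⊆ H) (hGcard : 2 * k + 1 ≤ G.card)
    (hGL : ∀ i ∈ H, G ⊆ L i)
    (T : Finset (Fin n)) (hT : T = H.filter (fun i => i ∈ L i))
    (Ti : Fin n → Finset (Fin n))
    (hTTi : ∀ i ∈ H, T ⊆ Ti i)
    (hTiH : ∀ i ∈ H, ∀ y ∈ Ti i, y ∈ H → y ∈ T)
    (vc : Fin n → Fin n → V) (Lc : Fin n → Fin n → Finset (Fin n))
    (hvc : ∀ i ∈ H, ∀ s ∈ H, vc i s = v s)
    (hLc : ∀ i ∈ H, ∀ s ∈ H, Lc i s = L s)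
    (m : Fin n → Fin n → WithTop V)
    (hm : ∀ i ∈ H, ∀ z : Fin n, m i z =
      (((Ti i).filter (fun y => y ∈ Lc i y ∧
          Relation.ReflTransGen (fun a b => a ∈ Ti i ∧ b ∈ Ti i ∧ a ∈ Lc i b) y z)).image
        (fun y => vc i y)).min)
    (out : Fin n → WithTop V)
    (hout : ∀ i ∈ H, ∃ z ∈ Ti i ∩ L i, out i = m i z)
    (hplur : ∀ i ∈ H, ∀ w : WithTop V,
      ((Ti i ∩ L i).filter (fun z => m i z = w)).card ≤
        ((Ti i ∩ L i).filter (fun z => m i z = out i)).card)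
    (w : V) (hunan : ∀ i ∈ H, v i = w) :
    ∀ i ∈ H, out i = (w : WithTop V) := by
  intro i hi
  obtain ⟨z, hz, hoz⟩ := hout i hi
  rw [Finset.mem_inter] at hz
  have hzH : z ∈ H := hLH i hi hz.2
  have hzT : z ∈ T := hTiH i hi z hz.1 hzH
  have hzL : z ∈ Lc i z := by
    rw [hLc i hi z hzH]
    rw [hT, Finset.mem_filter] at hzT
    exact hzT.2
  have hpath : ∀ y, Relation.ReflTransGen
      (fun a b => a ∈ Ti i ∧ b ∈ Ti i ∧ a ∈ Lc i b) y z → y ∈ H := by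
    intro y hy
    induction hy using Relation.ReflTransGen.head_induction_on with
    | refl => exact hzH
    | head hab _ ih =>
      have h := hab.2.2
      rw [hLc i hi _ ih] at h
      exact hLH _ ih h
  rw [hoz, hm i hi z]
  apply le_antisymm
  · apply Finset.min_le
    rw [Finset.mem_image]
    refine ⟨z, ?_, ?_⟩
    · rw [Finset.mem_filter]
      exact ⟨hz.1, hzL, Relation.ReflTransGen.refl⟩
    · rw [hvc i hi z hzH, hunan z hzH]
  · apply Finset.le_min
    intro a ha
    rw [Finset.mem_image] at ha
    obtain ⟨y, hy, rfl⟩ := ha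
    rw [Finset.mem_filter] at hy
    have hyH := hpath y hy.2.2
    rw [hvc i hi y hyH, hunan y hyH]
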